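/- arXiv:2105.08254 — 2 statements merged into one kernel-verified Lean document; each statement's English description precedes it below -/
import Mathlib

section
/- Let d < 0 be a squarefree integer with d ≡ 2,3 (mod 4) or d = −3, let F = ℚ(√d) ⊆ ℂ and let 𝒪_F be its ring of integers. Then for every z ∈ F and every unit ξ ∈ 𝒪_F^× with ξ ≠ 1 such that (1−ξ)·z ∈ 𝒪_F, there exists a unit u ∈ 𝒪_F^× with u·z + conj(u·z) ∈ ℤ. -/
noncomputable section

open Complex

/-- `√d := i·√|d|` for a (negative) integer `d`, as a complex number. -/
def sqrtD (d : ℤ) : ℂ := Complex.I * Real.sqrt (|d| : ℝ)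

/-- The ring of integers of `F = ℚ(√d)`, realized as the subring of `ℂ` consisting of
elements of `ℚ(√d)` that are integral over `ℤ`. -/
def Oring (d : ℤ) : Subring ℂ :=
  (integralClosure ℤ ℂ).toSubring ⊓ (Algebra.adjoin ℚ {sqrtD d}).toSubring

theorem sqrtD_conj (d : ℤ) : (starRingEnd ℂ) (sqrtD d) = - sqrtD d := by
  simp [sqrtD]

theorem sqrtD_sq (d : ℤ) (hd : d < 0) : sqrtD d * sqrtD d = (d : ℂ) := by
  have h1 : ((Real.sqrt (|d| : ℝ) : ℝ) : ℂ) * (Real.sqrt (|d| : ℝ) : ℝ) = ((-d : ℝ) : ℂ) := by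
    rw [← Complex.ofReal_mul, Real.mul_self_sqrt (abs_nonneg _), abs_of_neg (by exact_mod_cast hd)]
  have : sqrtD d * sqrtD d = (I * I) * (((Real.sqrt (|d| : ℝ) : ℝ) : ℂ) * (Real.sqrt (|d| : ℝ) : ℝ)) := by
    unfold sqrtD; ring
  rw [this, h1, I_mul_I]; push_cast; ring

theorem mem_adjoin_form (d : ℤ) (hd : d < 0) (z : ℂ) (hz : z ∈ Algebra.adjoin ℚ {sqrtD d}) :
    ∃ x y : ℚ, z = x + y * sqrtD d := by
  induction hz using Algebra.adjoin_induction with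
  | mem x hx => exact ⟨0, 1, by simpa using hx⟩
  | algebraMap r => exact ⟨r, 0, by simp⟩
  | add a b _ _ ha hb =>
    obtain ⟨x, y, rfl⟩ := ha
    obtain ⟨x', y', rfl⟩ := hb
    exact ⟨x + x', y + y', by push_cast; ring⟩
  | mul a b _ _ ha hb =>
    obtain ⟨x, y, rfl⟩ := ha
    obtain ⟨x', y', rfl⟩ := hb
    refine ⟨x * x' + y * y' * d, x * y' + x' * y, ?_⟩
    push_cast
    linear_combination (y : ℂ) * y' * sqrtD_sq d hd

theorem coord_inj (d : ℤ) (hd : d < 0) (x y x' y' : ℚ)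
    (h : (x : ℂ) + y * sqrtD d = x' + y' * sqrtD d) : x = x' ∧ y = y' := by
  have hs : Real.sqrt (|d| : ℝ) ≠ 0 := by
    have : (0 : ℝ) < |(d : ℝ)| := abs_pos.mpr (by exact_mod_cast hd.ne)
    exact (Real.sqrt_pos.mpr this).ne'
  have hre := congrArg Complex.re h
  have him := congrArg Complex.im h
  simp [sqrtD] at hre him
  refine ⟨by exact_mod_cast hre, ?_⟩
  rcases him with h | h
  · exact_mod_cast h
  · exact absurd h (by simpa using hd.ne)

theorem rat_int (r : ℚ) (h : IsIntegral ℤ (r : ℂ)) : ∃ a : ℤ, r = a := by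
  have h2 : IsIntegral ℤ (algebraMap ℚ ℂ r) := by simpa using h
  have h3 : IsIntegral ℤ r := (isIntegral_algebraMap_iff (algebraMap ℚ ℂ).injective).mp h2
  obtain ⟨a, ha⟩ := IsIntegrallyClosed.isIntegral_iff.mp h3
  exact ⟨a, by simpa using ha.symm⟩

theorem sqfree_int (d : ℤ) (hsf : Squarefree d) (b : ℚ) (k : ℤ) (h : d * b * b = k) :
    ∃ c : ℤ, b = c := by
  have hden : (b.den : ℚ) ≠ 0 := by exact_mod_cast b.den_nz
  have hb : b * b.den = b.num := Rat.mul_den_eq_num b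
  have e : (d : ℚ) * (b.num * b.num) = k * (b.den * b.den) := by
    rw [← hb, ← h]; ring
  have e' : d * (b.num * b.num) = k * ((b.den : ℤ) * b.den) := by exact_mod_cast e
  have hc : IsCoprime (b.den : ℤ) b.num :=
    (Int.isCoprime_iff_gcd_eq_one.mpr (by simpa [Int.gcd] using b.reduced)).symm
  have hc2 : IsCoprime ((b.den : ℤ) * b.den) (b.num * b.num) :=
    (hc.mul_left hc).mul_right (hc.mul_left hc)
  have hdvd : (b.den : ℤ) * b.den ∣ d := hc2.dvd_of_dvd_mul_right ⟨k, by rw [e']; ring⟩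
  have hu := hsf _ hdvd
  have h1 : b.den = 1 := by simpa [Int.isUnit_iff_natAbs_eq] using hu
  exact ⟨b.num, by rw [← hb, h1]; simp⟩

theorem O_form (d : ℤ) (hd : d < 0) (hsf : Squarefree d) (w : ℂ) (hw : w ∈ Oring d) :
    ∃ a b n : ℤ, 2 * w = a + b * sqrtD d ∧ a * a - d * b * b = 4 * n := by
  obtain ⟨hi, hF⟩ := hw
  replace hi : IsIntegral ℤ w := hi
  obtain ⟨x, y, hxy⟩ := mem_adjoin_form d hd w hF
  have hc : IsIntegral ℤ ((starRingEnd ℂ) w) := hi.map (starRingEnd ℂ).toIntAlgHom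
  have hcw : (starRingEnd ℂ) w = x - y * sqrtD d := by
    rw [hxy]; simp [sqrtD_conj]; ring
  obtain ⟨a, ha⟩ := rat_int (2 * x) (by
    have := hi.add hc
    rw [hcw, hxy] at this
    have e : ((2 * x : ℚ) : ℂ) = x + y * sqrtD d + (x - y * sqrtD d) := by push_cast; ring
    rw [e]; exact this)
  obtain ⟨n, hn⟩ := rat_int (x * x - d * y * y) (by
    have := hi.mul hc
    rw [hcw, hxy] at this
    have e : ((x * x - d * y * y : ℚ) : ℂ) = (x + y * sqrtD d) * (x - y * sqrtD d) := by
      push_cast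
      linear_combination (y : ℂ) * y * sqrtD_sq d hd
    rw [e]; exact this)
  obtain ⟨b, hb⟩ := sqfree_int d hsf (2 * y) (a * a - 4 * n) (by
    push_cast; rw [← ha, ← hn]; ring)
  refine ⟨a, b, n, ?_, ?_⟩
  · have ha' : (2 : ℂ) * x = a := by exact_mod_cast congrArg (Rat.cast : ℚ → ℂ) ha
    have hb' : (2 : ℂ) * y = b := by exact_mod_cast congrArg (Rat.cast : ℚ → ℂ) hb
    rw [hxy, ← ha', ← hb']; ring
  · have : (a : ℚ) * a - d * b * b = 4 * n := by rw [← ha, ← hb, ← hn]; ring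
    exact_mod_cast this

theorem trace_one (d : ℤ) (z : ℂ) (x y : ℚ) (hz : z = x + y * sqrtD d) (m : ℤ)
    (hm : 2 * x = m) :
    ∃ u : ℂ, u ∈ Oring d ∧ (∃ w ∈ Oring d, u * w = 1) ∧
      ∃ m : ℤ, u * z + (starRingEnd ℂ) (u * z) = (m : ℂ) := by
  refine ⟨1, one_mem _, ⟨1, one_mem _, by simp⟩, m, ?_⟩
  have hm' : (2 : ℂ) * x = m := by exact_mod_cast congrArg (Rat.cast : ℚ → ℂ) hm
  rw [hz, ← hm']; simp [sqrtD_conj]; ring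

theorem omega_mem (e : ℤ) (he : e * e = 1) : (1 + e * sqrtD (-3)) / 2 ∈ Oring (-3) := by
  have h3 := sqrtD_sq (-3) (by norm_num)
  have he' : (e : ℂ) * e = 1 := by exact_mod_cast he
  refine ⟨?_, ?_⟩
  · change IsIntegral ℤ _
    refine ⟨Polynomial.X ^ 2 - Polynomial.X + 1, by monicity!, ?_⟩
    simp
    push_cast at h3
    linear_combination (1 / 4 : ℂ) * sqrtD (-3) * sqrtD (-3) * he' + (1 / 4 : ℂ) * h3
  · change _ ∈ Algebra.adjoin ℚ {sqrtD (-3)}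
    have hs : sqrtD (-3) ∈ Algebra.adjoin ℚ {sqrtD (-3)} := Algebra.subset_adjoin rfl
    have h1 := Subalgebra.smul_mem _ (add_mem (one_mem _)
      (mul_mem (intCast_mem (Algebra.adjoin ℚ {sqrtD (-3)}) e) hs)) (1 / 2 : ℚ)
    convert h1 using 1
    rw [Algebra.smul_def]; simp; ring

theorem trace_omega (z : ℂ) (x y : ℚ) (hz : z = x + y * sqrtD (-3)) (e m : ℤ)
    (he : e * e = 1) (hm : x - 3 * e * y = m) :
    ∃ u : ℂ, u ∈ Oring (-3) ∧ (∃ w ∈ Oring (-3), u * w = 1) ∧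
      ∃ m : ℤ, u * z + (starRingEnd ℂ) (u * z) = (m : ℂ) := by
  have h3 := sqrtD_sq (-3) (by norm_num)
  push_cast at h3
  have he' : (e : ℂ) * e = 1 := by exact_mod_cast he
  refine ⟨_, omega_mem e he, ⟨_, omega_mem (-e) (by linarith), ?_⟩, m, ?_⟩
  · push_cast
    linear_combination (-1 / 4 : ℂ) * sqrtD (-3) * sqrtD (-3) * he' - (1 / 4 : ℂ) * h3
  · have hm' : (x : ℂ) - 3 * e * y = m := by exact_mod_cast congrArg (Rat.cast : ℚ → ℂ) hm
    rw [hz, ← hm']; simp [sqrtD_conj, map_ofNat]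
    linear_combination (e : ℂ) * y * h3

theorem parity_a (d a b n : ℤ) (hmod : d % 4 = 2 ∨ d % 4 = 3) (h : a * a - d * b * b = 4 * n) :
    2 ∣ a ∧ 2 ∣ b := by
  have h4 : (a * a - d * (b * b)) % 4 = 0 := by
    rw [← mul_assoc, h]; omega
  have ha : a % 4 = 0 ∨ a % 4 = 1 ∨ a % 4 = 2 ∨ a % 4 = 3 := by omega
  have hb : b % 4 = 0 ∨ b % 4 = 1 ∨ b % 4 = 2 ∨ b % 4 = 3 := by omega
  rcases hmod with hm | hm <;> rcases ha with ha | ha | ha | ha <;>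
    rcases hb with hb | hb | hb | hb <;>
    first
    | (constructor <;> omega)
    | (exfalso; simp [Int.sub_emod, Int.mul_emod, hm, ha, hb] at h4)

theorem parity_3 (a b n : ℤ) (h : a * a - (-3) * b * b = 4 * n) : 2 ∣ (a - b) := by
  have h4 : (a * a - b * b) % 2 = 0 := by
    have : a * a - b * b = 2 * (2 * n - 2 * (b * b)) := by linarith
    omega
  rcases Int.emod_two_eq_zero_or_one a with ha | ha <;>
  rcases Int.emod_two_eq_zero_or_one b with hb | hb <;>
    first
    | omega
    | (exfalso; simp [Int.sub_emod, Int.mul_emod, ha, hb] at h4)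

theorem exists_unit_trace_int
    (d : ℤ) (hd : d < 0) (hsf : Squarefree d)
    (hmod : d % 4 = 2 ∨ d % 4 = 3 ∨ d = -3)
    (z : ℂ) (hz : z ∈ Algebra.adjoin ℚ {sqrtD d})
    (ξ : ℂ) (hξO : ξ ∈ Oring d) (hξunit : ∃ η ∈ Oring d, ξ * η = 1) (hξne : ξ ≠ 1)
    (h : (1 - ξ) * z ∈ Oring d) :
    ∃ u : ℂ, u ∈ Oring d ∧ (∃ w ∈ Oring d, u * w = 1) ∧
      ∃ m : ℤ, u * z + (starRingEnd ℂ) (u * z) = (m : ℂ) := by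
  obtain ⟨η, hηO, hη⟩ := hξunit
  have hs := sqrtD_sq d hd
  obtain ⟨x, y, hxy⟩ := mem_adjoin_form d hd z hz
  obtain ⟨p, q, n, hpq, hn⟩ := O_form d hd hsf ξ hξO
  obtain ⟨r, s, k, hrs, hk⟩ := O_form d hd hsf η hηO
  obtain ⟨a, b, l, hab, hl⟩ := O_form d hd hsf _ h
  -- the norm of `ξ` is one
  have hnk : n * k = 1 := by
    have e1 : ((p * r + d * q * s : ℚ) : ℂ) + ((p * s + q * r : ℚ) : ℂ) * sqrtD d
        = (4 : ℚ) + (0 : ℚ) * sqrtD d := by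
      push_cast
      have : (2 * ξ) * (2 * η) = 4 := by linear_combination 4 * hη
      rw [hpq, hrs] at this
      linear_combination this - (q : ℂ) * s * hs
    obtain ⟨e2, e3⟩ := coord_inj d hd _ _ _ _ e1
    have e2' : p * r + d * q * s = 4 := by exact_mod_cast e2
    have e3' : p * s + q * r = 0 := by exact_mod_cast e3
    have : (4 * n) * (4 * k) = 16 := by
      rw [← hn, ← hk]
      linear_combination (p * r + d * q * s + 4) * e2' - d * (p * s + q * r) * e3'
    linarith
  have hn0 : 0 ≤ n := by nlinarith [mul_self_nonneg p, mul_self_nonneg q]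
  have hn1 : n = 1 := by
    rcases Int.eq_one_or_neg_one_of_mul_eq_one hnk with h | h <;> omega
  subst hn1
  have hp2 : p ≠ 2 := by
    rintro rfl
    have hq : q = 0 := by
      have : d * (q * q) = 0 := by linarith
      rcases mul_eq_zero.mp this with h | h
      · omega
      · exact mul_self_eq_zero.mp h
    subst hq
    apply hξne
    push_cast at hpq
    linear_combination hpq / 2
  have hple : p ≤ 2 := by nlinarith [mul_self_nonneg q]
  have hpge : -2 ≤ p := by nlinarith [mul_self_nonneg q]
  -- coordinates
  have e1 : (((2 - p) * x - d * q * y : ℚ) : ℂ) + (((2 - p) * y - q * x : ℚ) : ℂ) * sqrtD d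
      = (a : ℚ) + (b : ℚ) * sqrtD d := by
    push_cast
    rw [← hab, hxy]
    linear_combination ((x : ℂ) + y * sqrtD d) * hpq - (q : ℂ) * y * hs * (-1)
  obtain ⟨e2, e3⟩ := coord_inj d hd _ _ _ _ e1
  have hnQ : (p : ℚ) * p - d * q * q = 4 := by exact_mod_cast hn
  have e4 : (8 - 4 * (p : ℚ)) * x = a * (2 - p) + q * d * b := by
    linear_combination (2 - (p : ℚ)) * e2 + (d : ℚ) * q * e3 - x * hnQ
  by_cases hd3 : d = -3
  · subst hd3
    obtain ⟨t, ht⟩ := parity_3 a b l hl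
    have hq1 : q ≤ 1 := by nlinarith [mul_self_nonneg p]
    have hq2 : -1 ≤ q := by nlinarith [mul_self_nonneg p]
    have htQ : (a : ℚ) - b = 2 * t := by exact_mod_cast ht
    interval_cases p <;> interval_cases q <;> norm_num at hn <;> norm_num at hp2 <;>
      norm_num at e4 e3 e2
    · -- `ξ = -1`
      rcases Int.even_or_odd' a with ⟨c, hc | hc⟩
      · have : (a : ℚ) = 2 * c := by exact_mod_cast hc
        exact trace_one _ z x y hxy c (by linarith)
      · have hcQ : (a : ℚ) = 2 * c + 1 := by exact_mod_cast hc
        rcases Int.even_or_odd' t with ⟨v, hv | hv⟩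
        · have hvQ : (t : ℚ) = 2 * v := by exact_mod_cast hv
          refine trace_omega z x y hxy (-1) (a - 3 * v) (by norm_num) ?_
          push_cast; linarith
        · have hvQ : (t : ℚ) = 2 * v + 1 := by exact_mod_cast hv
          refine trace_omega z x y hxy 1 (-c + 3 * v + 1) (by norm_num) ?_
          push_cast; linarith
    · exact trace_one _ z x y hxy (t + b) (by push_cast; linarith)
    · exact trace_one _ z x y hxy t (by push_cast; linarith)
    · exact trace_one _ z x y hxy (t + 2 * b) (by push_cast; linarith)
    · exact trace_one _ z x y hxy (t - b) (by push_cast; linarith)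
  · have hmod' : d % 4 = 2 ∨ d % 4 = 3 := by tauto
    obtain ⟨⟨p', hp'⟩, q', hq'⟩ := parity_a d p q 1 hmod' hn
    obtain ⟨⟨a', ha'⟩, b', hb'⟩ := parity_a d a b l hmod' hl
    have hpp : p = 0 ∨ p = -2 := by omega
    subst hq' ha' hb'
    push_cast at e4
    rcases hpp with rfl | rfl
    · exact trace_one _ z x y hxy (a' + q' * d * b') (by push_cast at e4 ⊢; linarith)
    · have hq : q' = 0 := by
        have : d * (q' * q') = 0 := by linarith
        rcases mul_eq_zero.mp this with h | h
        · omega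
        · exact mul_self_eq_zero.mp h
      subst hq
      exact trace_one _ z x y hxy a' (by push_cast at e4 ⊢; linarith)
end
end

section
/- For the Hermitian lattice Λ₆ = ℤ[i]⁶ with Gram matrix G as below: for every r ∈ Λ₆ with ⟨r,r⟩ = −1, the quasi-reflection τ_{r,i}, given by τ_{r,i}(ℓ) = ℓ + (1−i)⟨ℓ,r⟩·r, maps Λ₆ into Λ₆; consequently τ_{r,i} ∈ U(Λ₆). -/
noncomputable section

open Complex

/-- `z` is a Gaussian integer, i.e. lies in `ℤ[i] ⊆ ℂ`. -/
def inGZ (z : ℂ) : Prop := ∃ a b : ℤ, z = (a : ℂ) + (b : ℂ) * Complex.I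

/-- A vector lies in the lattice `Λ₆ = ℤ[i]⁶`. -/
def lat6 (v : Fin 6 → ℂ) : Prop := ∀ j, inGZ (v j)

/-- The Gram matrix `G`: block diagonal with blocks `G₁ = (1/2)[[0,1+i],[1-i,0]]` (the Gram
matrix of `Λ_{U⊕U(2)}`) and `G₂ = -[[2,-i,-i,1],[i,2,1,i],[i,1,2,1],[1,-i,1,2]]` (the Gram
matrix of `Λ_{E8(-1)}(2)`). -/
def G6 : Matrix (Fin 6) (Fin 6) ℂ :=
  !![0, (1 + Complex.I) / 2, 0, 0, 0, 0;
     (1 - Complex.I) / 2, 0, 0, 0, 0, 0;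
     0, 0, -2, Complex.I, Complex.I, -1;
     0, 0, -Complex.I, -2, -1, -Complex.I;
     0, 0, -Complex.I, -1, -2, -1;
     0, 0, -1, Complex.I, -1, -2]

/-- The Hermitian form `⟨v,w⟩ = Σ_{j,k} G_{jk} v_j conj(w_k)` on `ℂ⁶`. -/
def herm6 (v w : Fin 6 → ℂ) : ℂ :=
  ∑ j : Fin 6, ∑ k : Fin 6, G6 j k * v j * (starRingEnd ℂ) (w k)

theorem inGZ_int (n : ℤ) : inGZ (n : ℂ) := ⟨n, 0, by simp⟩

theorem inGZ_I : inGZ Complex.I := ⟨0, 1, by simp⟩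

theorem inGZ_add {x y : ℂ} (hx : inGZ x) (hy : inGZ y) : inGZ (x + y) := by
  obtain ⟨a, b, rfl⟩ := hx
  obtain ⟨c, d, rfl⟩ := hy
  exact ⟨a + c, b + d, by push_cast; ring⟩

theorem inGZ_mul {x y : ℂ} (hx : inGZ x) (hy : inGZ y) : inGZ (x * y) := by
  obtain ⟨a, b, rfl⟩ := hx
  obtain ⟨c, d, rfl⟩ := hy
  refine ⟨a * c - b * d, a * d + b * c, ?_⟩
  push_cast
  linear_combination ((b : ℂ) * d) * Complex.I_sq

theorem inGZ_conj {x : ℂ} (hx : inGZ x) : inGZ ((starRingEnd ℂ) x) := by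
  obtain ⟨a, b, rfl⟩ := hx
  exact ⟨a, -b, by simp⟩

theorem inGZ_sum (f : Fin 6 → ℂ) (h : ∀ j, inGZ (f j)) : inGZ (∑ j, f j) := by
  refine Finset.sum_induction f inGZ (fun _ _ => inGZ_add) ?_ (fun j _ => h j)
  exact ⟨0, 0, by simp⟩

/-- All entries of `(1 - i) G` are Gaussian integers. -/
theorem inGZ_G6 (j k : Fin 6) : inGZ ((1 - Complex.I) * G6 j k) := by
  have h2 := Complex.I_sq
  fin_cases j <;> fin_cases k <;> simp [G6] <;>
  first
    | (refine ⟨0, 0, ?_⟩; simp; done)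
    | (refine ⟨1, 0, ?_⟩; push_cast; linear_combination (-1/2) * h2; done)
    | (refine ⟨0, -1, ?_⟩; push_cast; linear_combination (1/2) * h2; done)
    | (refine ⟨-2, 2, ?_⟩; push_cast; ring1)
    | (refine ⟨-1, 1, ?_⟩; push_cast; ring1)
    | (refine ⟨1, 1, ?_⟩; push_cast; linear_combination (-1) * h2; done)
    | (refine ⟨-1, -1, ?_⟩; push_cast; linear_combination h2; done)

theorem inGZ_herm6 (v w : Fin 6 → ℂ) (hv : lat6 v) (hw : lat6 w) :
    inGZ ((1 - Complex.I) * herm6 v w) := by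
  unfold herm6
  simp only [Finset.mul_sum]
  refine inGZ_sum _ fun j => inGZ_sum _ fun k => ?_
  have h := inGZ_mul (inGZ_mul (inGZ_G6 j k) (hv j)) (inGZ_conj (hw k))
  convert h using 1
  ring

theorem lat6_add_smul {v r : Fin 6 → ℂ} {c : ℂ} (hv : lat6 v) (hr : lat6 r) (hc : inGZ c) :
    lat6 (v + c • r) := fun j => inGZ_add (hv j) (inGZ_mul hc (hr j))

theorem herm6_add_smul_left (v r w : Fin 6 → ℂ) (c : ℂ) :
    herm6 (v + c • r) w = herm6 v w + c * herm6 r w := by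
  simp only [herm6, Finset.mul_sum, ← Finset.sum_add_distrib]
  refine Finset.sum_congr rfl fun j _ => Finset.sum_congr rfl fun k _ => ?_
  simp only [Pi.add_apply, Pi.smul_apply, smul_eq_mul]
  ring

theorem G6_conj (j k : Fin 6) : (starRingEnd ℂ) (G6 j k) = G6 k j := by
  have h2 : (starRingEnd ℂ) (2 : ℂ) = 2 := Complex.conj_ofNat 2
  fin_cases j <;> fin_cases k <;> simp [G6, h2, sub_eq_add_neg]

theorem herm6_conj (v w : Fin 6 → ℂ) : (starRingEnd ℂ) (herm6 v w) = herm6 w v := by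
  simp only [herm6, map_sum, map_mul, Complex.conj_conj, G6_conj]
  rw [Finset.sum_comm]
  refine Finset.sum_congr rfl fun j _ => Finset.sum_congr rfl fun k _ => ?_
  ring

theorem herm6_add_smul_right (v w r : Fin 6 → ℂ) (c : ℂ) :
    herm6 v (w + c • r) = herm6 v w + (starRingEnd ℂ) c * herm6 v r := by
  rw [← herm6_conj, herm6_add_smul_left, map_add, map_mul, herm6_conj, herm6_conj]

/-- For every `r ∈ Λ₆` with `⟨r,r⟩ = -1`, the quasi-reflection
`τ_{r,i} : ℓ ↦ ℓ + (1-i)⟨ℓ,r⟩·r` maps `Λ₆` into `Λ₆`; consequently `τ_{r,i} ∈ U(Λ₆)`, i.e. it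
restricts to a (ℤ[i]-linear) automorphism of `Λ₆` preserving `⟨·,·⟩`. -/
theorem quasiReflection_i_mem_unitary_lat6
    (r : Fin 6 → ℂ) (hr : lat6 r) (hrr : herm6 r r = -1) :
    (∀ ℓ, lat6 ℓ → lat6 (ℓ + ((1 - Complex.I) * herm6 ℓ r) • r)) ∧
    Set.BijOn (fun ℓ : Fin 6 → ℂ => ℓ + ((1 - Complex.I) * herm6 ℓ r) • r)
      {v | lat6 v} {v | lat6 v} ∧
    (∀ v w : Fin 6 → ℂ, lat6 v → lat6 w →
      herm6 (v + ((1 - Complex.I) * herm6 v r) • r)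
        (w + ((1 - Complex.I) * herm6 w r) • r) = herm6 v w) := by
  have hmaps : ∀ ℓ, lat6 ℓ → lat6 (ℓ + ((1 - Complex.I) * herm6 ℓ r) • r) := fun ℓ hℓ =>
    lat6_add_smul hℓ hr (inGZ_herm6 ℓ r hℓ hr)
  have hI := Complex.I_sq
  refine ⟨hmaps, ?_, ?_⟩
  · refine Set.BijOn.mk (fun ℓ hℓ => hmaps ℓ hℓ) ?_ ?_
    · intro v _ w _ h
      have h' : v + ((1 - Complex.I) * herm6 v r) • r
          = w + ((1 - Complex.I) * herm6 w r) • r := h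
      have e := congrArg (fun x => herm6 x r) h'
      simp only [herm6_add_smul_left, hrr] at e
      have e2 : herm6 v r = herm6 w r := by
        refine mul_left_cancel₀ Complex.I_ne_zero ?_
        linear_combination e
      rw [e2] at h'
      exact add_right_cancel h'
    · intro w hw
      refine ⟨w + (Complex.I * ((1 - Complex.I) * herm6 w r)) • r,
        lat6_add_smul hw hr (inGZ_mul inGZ_I (inGZ_herm6 w r hw hr)), ?_⟩
      funext j
      simp only [herm6_add_smul_left, hrr, Pi.add_apply, Pi.smul_apply, smul_eq_mul]
      linear_combination (herm6 w r * r j * (1 - Complex.I)) * hI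
  · intro v w _ _
    simp only [herm6_add_smul_left, herm6_add_smul_right, hrr, map_mul, map_sub, map_one,
      Complex.conj_I, herm6_conj]
    linear_combination (herm6 v r * herm6 r w) * hI
end
end
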